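/- In any execution of the coding scheme Π (Algorithms 1–2) on inputs (x,y) with an arbitrary erasure pattern, for every round i with 1 ≤ i ≤ t_A+1, one of the following two conditions holds: (1) r_B(i) = r_A(i) and T^B(i) = T^A(i); or (2) r_B(i) = r_A(i)+1 and T^B(i) = T^A(i)∘b_A(i−1)∘b_B(i−1). Furthermore, in either case, T^A(i) and T^B(i) are prefixes of the noiseless transcript T^π. -/

import Mathlib

/-!
Model of the coding scheme Π (Algorithms 1–2) of "Interactive coding resilient to an
unknown number of erasures".  A noiseless alternating binary protocol `π` of length `N`
is given by next-bit functions `fA fB : List Bool → Bool` (`fA t = π(x∣t)` on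
even-length transcripts `t`, `fB t = π(y∣t)` on odd-length transcripts `t`).
Rounds are 1-indexed; round `i` consists of two timesteps whose erasures are given by
`(E i).1` (odd timestep, Alice → Bob) and `(E i).2` (even timestep, Bob → Alice).
-/

namespace Scheme1

/-- Parity of a round number, as a Boolean. -/
def par (r : ℕ) : Bool := decide (r % 2 = 1)

/-- The joint state of Alice and Bob at the beginning of a round:
Alice's partial transcript `TA` and round counter `rA`; Bob's partial transcript `TB`,
round counter `rB`, error flag `err` and stored message `m = (bit, parity)`. -/
structure St where
  TA : List Bool
  rA : ℕ
  TB : List Bool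
  rB : ℕ
  err : Bool
  m : Bool × Bool
deriving DecidableEq

/-- The initial state. -/
def init : St := ⟨[], 0, [], 0, false, (false, false)⟩

/-- The information bit `b_B(i)` Bob sends in a round, given the erasure `e1` of the
round's odd timestep and the state `s` at the beginning of the round. -/
def bobSentBit (fA fB : List Bool → Bool) (e1 : Bool) (s : St) : Bool :=
  let b := fA s.TA
  let bobErr : Bool := e1 || (par (s.rA + 1) == par s.rB)
  if bobErr then s.m.1 else fB (s.TB ++ [b])

/-- One round of the coding scheme Π of Algorithms 1–2; `e.1`/`e.2` tell whether the
odd/even timestep of the round is erased.  After Alice terminates (`rA = N/2`) the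
recorded state no longer changes (Bob only resends his stored message upon erasures,
and terminates upon hearing silence). -/
def step (fA fB : List Bool → Bool) (N : ℕ) (e : Bool × Bool) (s : St) : St :=
  if s.rA < N / 2 then
    -- odd timestep: Alice extends and sends (b, parity)
    let b := fA s.TA
    let rA1 := s.rA + 1
    -- Bob receives (⊥ if e.1)
    let bobErr : Bool := e.1 || (par rA1 == par s.rB)
    let TB' := if bobErr then s.TB else (s.TB ++ [b]) ++ [fB (s.TB ++ [b])]
    let rB' := if bobErr then s.rB else s.rB + 1
    let m' := if bobErr then s.m else (fB (s.TB ++ [b]), par (s.rB + 1))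
    -- even timestep: Bob sends m'; Alice receives (⊥ if e.2)
    let aliceOk : Bool := !e.2 && (m'.2 == par rA1)
    let TA' := if aliceOk then (s.TA ++ [b]) ++ [m'.1] else s.TA
    let rA' := if aliceOk then rA1 else s.rA
    ⟨TA', rA', TB', rB', bobErr, m'⟩
  else s

/-- `exec fA fB N E k` is the state after `k` rounds have been played. -/
def exec (fA fB : List Bool → Bool) (N : ℕ) (E : ℕ → Bool × Bool) : ℕ → St
  | 0 => init
  | k + 1 => step fA fB N (E (k + 1)) (exec fA fB N E k)

/-- `stAt fA fB N E i` is the state at the beginning of round `i` (rounds 1-indexed):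
for a protocol variable `v`, `v(i) = (stAt … i).v`. -/
def stAt (fA fB : List Bool → Bool) (N : ℕ) (E : ℕ → Bool × Bool) (i : ℕ) : St :=
  exec fA fB N E (i - 1)

/-- The noiseless transcript of `π` after `r` rounds; `transcript fA fB (N/2)` is `T^π`. -/
def transcript (fA fB : List Bool → Bool) : ℕ → List Bool
  | 0 => []
  | r + 1 =>
    let t := transcript fA fB r
    (t ++ [fA t]) ++ [fB (t ++ [fA t])]

theorem par_succ (r : ℕ) : par (r + 1) = !par r := by
  unfold par
  rcases Nat.mod_two_eq_zero_or_one r with h | h <;> simp [Nat.add_mod, h]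

/-- The synchronization invariant: both transcripts are truncations of the noiseless
transcript, and Bob is at most one round ahead of Alice, in which case his stored message
carries the bit Alice is missing. -/
structure Synced (fA fB : List Bool → Bool) (N : ℕ) (s : St) : Prop where
  TA_eq : s.TA = transcript fA fB s.rA
  TB_eq : s.TB = transcript fA fB s.rB
  parity : s.m.2 = par s.rB
  rB_le : s.rB ≤ N / 2
  shift : s.rB = s.rA ∨ s.rB = s.rA + 1 ∧ s.m.1 = fB (s.TA ++ [fA s.TA])

theorem synced_init (fA fB : List Bool → Bool) (N : ℕ) : Synced fA fB N init :=
  ⟨rfl, rfl, rfl, Nat.zero_le _, Or.inl rfl⟩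

theorem Synced.step {fA fB : List Bool → Bool} {N : ℕ} {s : St} (h : Synced fA fB N s)
    (e : Bool × Bool) : Synced fA fB N (step fA fB N e s) := by
  by_cases hlt : s.rA < N / 2
  swap
  · simpa [Scheme1.step, hlt] using h
  obtain ⟨TA, rA, TB, rB, err, m, p⟩ := s
  obtain ⟨hA, hB, hp, hle, hs⟩ := h
  obtain ⟨e₁, e₂⟩ := e
  dsimp only at hA hB hp hle hs hlt
  subst hA hB hp
  rcases hs with rfl | ⟨rfl, rfl⟩ <;> cases e₁ <;> cases e₂ <;> constructor <;>
    simp [Scheme1.step, hlt, par_succ, transcript] <;> omega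

/-- If Bob is ahead after an active round, the last two bits of his transcript are the
information bits exchanged in that round. -/
theorem Synced.step_shift {fA fB : List Bool → Bool} {N : ℕ} {s : St}
    (h : Synced fA fB N s) (hlt : s.rA < N / 2) (e : Bool × Bool)
    (hshift : (Scheme1.step fA fB N e s).rB = (Scheme1.step fA fB N e s).rA + 1) :
    (Scheme1.step fA fB N e s).TB =
      ((Scheme1.step fA fB N e s).TA ++ [fA s.TA]) ++ [bobSentBit fA fB e.1 s] := by
  obtain ⟨TA, rA, TB, rB, err, m, p⟩ := s
  obtain ⟨hA, hB, hp, hle, hs⟩ := h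
  obtain ⟨e₁, e₂⟩ := e
  dsimp only at hA hB hp hle hs hlt
  subst hA hB hp
  rcases hs with rfl | ⟨rfl, rfl⟩ <;> cases e₁ <;> cases e₂ <;>
    simp_all [Scheme1.step, bobSentBit, par_succ, transcript]

theorem synced_exec (fA fB : List Bool → Bool) (N : ℕ) (E : ℕ → Bool × Bool) (k : ℕ) :
    Synced fA fB N (exec fA fB N E k) := by
  induction k with
  | zero => exact synced_init fA fB N
  | succ k ih => exact ih.step (E (k + 1))

theorem transcript_prefix (fA fB : List Bool → Bool) {r n : ℕ} (h : r ≤ n) :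
    transcript fA fB r <+: transcript fA fB n := by
  induction n, h using Nat.le_induction with
  | base => exact List.prefix_rfl
  | succ n _ ih =>
    exact ih.trans (by simp [transcript])

/-- Lemma 4 of the paper.  In any execution of Π, for every round
`1 ≤ i ≤ t_A + 1`, either `r_B(i) = r_A(i)` and `T^B(i) = T^A(i)`, or
`r_B(i) = r_A(i) + 1` and `T^B(i) = T^A(i)∘b_A(i-1)∘b_B(i-1)`; in either case both
partial transcripts are prefixes of the noiseless transcript `T^π`. -/
theorem scheme1_shift_sync
    (fA fB : List Bool → Bool) (N : ℕ) (hN : 0 < N) (hNeven : Even N)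
    (E : ℕ → Bool × Bool) (tA : ℕ)
    (htA1 : ∀ i, 1 ≤ i → i ≤ tA → (stAt fA fB N E i).rA < N / 2)
    (htA2 : (stAt fA fB N E (tA + 1)).rA = N / 2)
    (i : ℕ) (hi1 : 1 ≤ i) (hi2 : i ≤ tA + 1)
    (s sprev : St) (hs : s = stAt fA fB N E i) (hsprev : sprev = stAt fA fB N E (i - 1)) :
    ((s.rB = s.rA ∧ s.TB = s.TA) ∨
      (s.rB = s.rA + 1 ∧
        s.TB = (s.TA ++ [fA sprev.TA]) ++ [bobSentBit fA fB (E (i - 1)).1 sprev])) ∧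
    s.TA <+: transcript fA fB (N / 2) ∧
    s.TB <+: transcript fA fB (N / 2) := by
  subst hs hsprev
  obtain ⟨k, rfl⟩ : ∃ k, i = k + 1 := ⟨i - 1, by omega⟩
  have h : Synced fA fB N (stAt fA fB N E (k + 1)) := synced_exec fA fB N E k
  have hle := h.rB_le
  refine ⟨?_, ?_, ?_⟩
  · rcases h.shift with heq | ⟨heq, -⟩
    · exact Or.inl ⟨heq, by rw [h.TA_eq, h.TB_eq, heq]⟩
    · refine Or.inr ⟨heq, ?_⟩
      cases k with
      | zero => simp [stAt, exec, init] at heq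
      | succ k =>
        exact (synced_exec fA fB N E k).step_shift (htA1 (k + 1) (by omega) (by omega))
          (E (k + 1)) heq
  · rw [h.TA_eq]
    refine transcript_prefix fA fB ?_
    rcases h.shift with heq | ⟨heq, -⟩ <;> omega
  · rw [h.TB_eq]
    exact transcript_prefix fA fB hle

end Scheme1
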